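/- Let A be a J-algebra and a, b ∈ A with a˘;a ≤ 1', b˘;b ≤ 1', 1 = a˘;b, 1 = a;1 = b;1, and (a;a˘)·(b;b˘) ≤ 1'. Define K = a, L = b, U = a˘·b˘, P = a;b˘ · b;a˘, P₀ = a;P;a˘ · b;b˘, R = a;a˘;a˘ · b;a;b˘;a˘ · b;b;b˘, R₀ = a;R;a˘ · b;b˘, B = a;a˘ · b;R;b˘, C = a;b˘;b˘ · b;a;a˘ · b;b;a˘;b˘, and π₀ = a;a˘;b˘ · b;a;a˘ · b;b;b˘;b˘. Then K, L, U, and U˘ are functional, and P, P₀, R, R₀, B, C, and π₀ are permutational. -/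

import Mathlib

/-- A J-algebra: an algebra (A, ·, 0, 1, ;, ˘, 1') satisfying Jónsson's axioms. -/
structure JAlgebra (A : Type*) where
  meet : A → A → A        -- Boolean product ·
  comp : A → A → A        -- relative product ;
  conv : A → A            -- converse ˘
  zero : A                -- 0
  one : A                 -- 1
  ident : A               -- 1'
  massoc : ∀ x y z, meet x (meet y z) = meet (meet x y) z
  mcomm : ∀ x y, meet x y = meet y x
  midem : ∀ x, meet x x = x
  cassoc : ∀ x y z, comp x (comp y z) = comp (comp x y) z
  cid : ∀ x, comp x ident = x
  semidist : ∀ x y z, comp (meet x y) z = meet (comp (meet x y) z) (comp y z)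
  convconv : ∀ x, conv (conv x) = x
  convcomp : ∀ x y, conv (comp x y) = comp (conv y) (conv x)
  convmeet : ∀ x y, conv (meet x y) = meet (conv x) (conv y)
  rot : ∀ x y z, meet (comp x y) z =
    meet (comp (meet (comp z (conv y)) x) (meet y (comp (conv x) z))) z
  zbot : ∀ x, meet zero x = zero
  otop : ∀ x, meet x one = x
  comp_zero : ∀ x, comp x zero = zero

/-- x ≤ y iff x·y = x. -/
def JAlgebra.le {A : Type*} (J : JAlgebra A) (x y : A) : Prop := J.meet x y = x

/-- x is functional iff x˘;x ≤ 1'. -/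
def JAlgebra.Functional {A : Type*} (J : JAlgebra A) (x : A) : Prop :=
  J.le (J.comp (J.conv x) x) J.ident

/-- x is permutational iff x;x˘ = 1' = x˘;x. -/
def JAlgebra.Permutational {A : Type*} (J : JAlgebra A) (x : A) : Prop :=
  J.comp x (J.conv x) = J.ident ∧ J.comp (J.conv x) x = J.ident

namespace JAlgebra

variable {A : Type*} (J : JAlgebra A)

theorem le_trans {x y z : A} (h : J.le x y) (k : J.le y z) : J.le x z := by
  unfold le at *
  rw [← h, ← J.massoc, k]

theorem le_antisymm {x y : A} (h : J.le x y) (k : J.le y x) : x = y := by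
  unfold le at *
  rw [← h, J.mcomm, k]

theorem meet_le_left (x y : A) : J.le (J.meet x y) x := by
  unfold le
  rw [J.mcomm, J.massoc, J.midem]

theorem meet_le_right (x y : A) : J.le (J.meet x y) y := by
  unfold le
  rw [← J.massoc, J.midem]

theorem le_meet {x y z : A} (h : J.le x y) (k : J.le x z) : J.le x (J.meet y z) := by
  unfold le at *
  rw [J.massoc, h, k]

theorem meet_mono {x y z w : A} (h : J.le x y) (k : J.le z w) :
    J.le (J.meet x z) (J.meet y w) :=
  J.le_meet (J.le_trans (J.meet_le_left _ _) h) (J.le_trans (J.meet_le_right _ _) k)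

theorem conv_mono {x y : A} (h : J.le x y) : J.le (J.conv x) (J.conv y) := by
  unfold le at *
  rw [← J.convmeet, h]

theorem conv_ident : J.conv J.ident = J.ident := by
  have h := J.convcomp (J.conv J.ident) J.ident
  rwa [J.cid, J.convconv, J.cid, eq_comm] at h

theorem ident_comp (x : A) : J.comp J.ident x = x := by
  rw [← J.convconv (J.comp J.ident x), J.convcomp, J.conv_ident, J.cid, J.convconv]

theorem comp_mono_left {x y : A} (h : J.le x y) (z : A) :
    J.le (J.comp x z) (J.comp y z) := by
  have k := J.semidist x y z
  unfold le at *
  rw [h] at k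
  exact k.symm

theorem comp_mono_right {x y : A} (h : J.le x y) (z : A) :
    J.le (J.comp z x) (J.comp z y) := by
  have k := J.conv_mono (J.comp_mono_left (J.conv_mono h) (J.conv z))
  simpa only [J.convcomp, J.convconv] using k

theorem comp_mono {x y z w : A} (h : J.le x y) (k : J.le z w) :
    J.le (J.comp x z) (J.comp y w) :=
  J.le_trans (J.comp_mono_left h z) (J.comp_mono_right k y)

theorem conv_one : J.conv J.one = J.one := by
  have h := J.otop (J.conv J.one)
  have k := J.conv_mono h
  rw [J.convconv] at k
  exact J.le_antisymm h k

/-- An element is a map when it is functional and total. -/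
def IsMap (x : A) : Prop :=
  J.Functional x ∧ J.le J.ident (J.comp x (J.conv x))

variable {J}

theorem IsMap.permutational {x : A} (h : J.IsMap x) (k : J.IsMap (J.conv x)) :
    J.Permutational x := by
  obtain ⟨h₁, h₂⟩ := h
  obtain ⟨k₁, k₂⟩ := k
  unfold Functional at *
  rw [J.convconv] at k₁ k₂
  exact ⟨J.le_antisymm k₁ h₂, J.le_antisymm h₁ k₂⟩

theorem Permutational.isMap {x : A} (h : J.Permutational x) : J.IsMap x := by
  obtain ⟨h₁, h₂⟩ := h
  unfold IsMap Functional le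
  rw [h₁, h₂]
  exact ⟨J.midem _, J.midem _⟩

theorem Permutational.conv {x : A} (h : J.Permutational x) : J.Permutational (J.conv x) := by
  unfold Permutational at *
  rw [J.convconv]
  exact ⟨h.2, h.1⟩

theorem IsMap.comp {x y : A} (h : J.IsMap x) (k : J.IsMap y) : J.IsMap (J.comp x y) := by
  obtain ⟨h₁, h₂⟩ := h
  obtain ⟨k₁, k₂⟩ := k
  unfold IsMap Functional at *
  rw [J.convcomp]
  constructor
  · have e := J.comp_mono_left (J.comp_mono_right h₁ (J.conv y)) y
    rw [J.cid] at e
    simp only [J.cassoc] at e ⊢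
    exact J.le_trans e k₁
  · have e := J.comp_mono_left (J.comp_mono_right k₂ x) (J.conv x)
    rw [J.cid] at e
    simp only [J.cassoc] at e ⊢
    exact J.le_trans h₂ e

theorem IsMap.comp_one {x : A} (h : J.IsMap x) : J.comp x J.one = J.one := by
  refine J.le_antisymm (J.otop _) ?_
  have e := J.comp_mono_left h.2 J.one
  rw [J.ident_comp, ← J.cassoc] at e
  exact J.le_trans e (J.comp_mono_right (J.otop _) x)

theorem IsMap.of_comp_one {x : A} (h : J.Functional x) (k : J.one = J.comp x J.one) :
    J.IsMap x := by
  refine ⟨h, ?_⟩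
  have e := J.rot x J.one J.ident
  rw [← k, J.mcomm J.one, J.otop, J.cid, J.mcomm J.one, J.otop] at e
  have f := J.meet_le_left
    (J.comp (J.meet (J.comp J.ident (J.conv J.one)) x) (J.conv x)) J.ident
  rw [← e] at f
  exact J.le_trans f (J.comp_mono_left (J.meet_le_right _ _) _)

theorem Functional.meet_comp_conv {c : A} (h : J.Functional c) (x y : A) :
    J.comp (J.meet x y) (J.conv c) =
      J.meet (J.comp x (J.conv c)) (J.comp y (J.conv c)) := by
  refine J.le_antisymm (J.le_meet (J.comp_mono_left (J.meet_le_left _ _) _)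
    (J.comp_mono_left (J.meet_le_right _ _) _)) ?_
  rw [J.rot, J.convconv]
  refine J.le_trans (J.meet_le_left _ _) (J.comp_mono ?_ (J.meet_le_left _ _))
  rw [J.mcomm x]
  refine J.meet_mono ?_ (J.midem x)
  have e := J.comp_mono_right h y
  rwa [J.cid, J.cassoc] at e

theorem le_meet_comp_conv_meet {x y : A} (h : J.le J.ident (J.comp x (J.conv y))) :
    J.le J.ident (J.comp (J.meet x y) (J.conv (J.meet x y))) := by
  have e := J.rot x (J.conv y) J.ident
  rw [J.convconv, J.ident_comp, J.cid, J.mcomm (J.comp x _), h, J.mcomm y, J.mcomm (J.conv y),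
    ← J.convmeet] at e
  unfold le
  rw [J.mcomm]
  exact e.symm

variable (J) in
/-- The elements `a` and `b` are total functional projections for which every pair of points
has exactly one pairing. -/
structure IsPairing (a b : A) : Prop where
  fst : J.IsMap a
  snd : J.IsMap b
  surj : J.comp (J.conv a) b = J.one
  inj : J.le (J.meet (J.comp a (J.conv a)) (J.comp b (J.conv b))) J.ident

namespace IsPairing

variable {a b : A}

theorem isMap_meet (h : J.IsPairing a b) {f g : A} (hf : J.IsMap f) (hg : J.IsMap g) :
    J.IsMap (J.meet (J.comp f (J.conv a)) (J.comp g (J.conv b))) := by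
  constructor
  · have key {c k : A} (hk : J.IsMap k) :
        J.le (J.comp (J.conv (J.comp k (J.conv c))) (J.comp k (J.conv c)))
          (J.comp c (J.conv c)) := by
      have e := J.comp_mono_left (J.comp_mono_right hk.1 c) (J.conv c)
      rw [J.cid] at e
      simpa only [J.convcomp, J.convconv, J.cassoc] using e
    refine J.le_trans (J.le_meet ?_ ?_) h.inj
    · exact J.le_trans (J.comp_mono (J.conv_mono (J.meet_le_left _ _)) (J.meet_le_left _ _))
        (key hf)
    · exact J.le_trans (J.comp_mono (J.conv_mono (J.meet_le_right _ _)) (J.meet_le_right _ _))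
        (key hg)
  · apply le_meet_comp_conv_meet
    have e := congrArg J.conv hg.comp_one
    rw [J.convcomp, J.conv_one] at e
    rw [J.convcomp, J.convconv, J.cassoc, ← J.cassoc f, h.surj, hf.comp_one, e]
    exact J.otop _

theorem permutational_map_fst (h : J.IsPairing a b) {x : A} (hx : J.Permutational x) :
    J.Permutational
      (J.meet (J.comp (J.comp a x) (J.conv a)) (J.comp b (J.conv b))) := by
  refine (h.isMap_meet (h.fst.comp hx.isMap) h.snd).permutational ?_
  simpa only [J.convmeet, J.convcomp, J.convconv, J.cassoc] using
    h.isMap_meet (h.fst.comp hx.conv.isMap) h.snd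

theorem permutational_map_snd (h : J.IsPairing a b) {x : A} (hx : J.Permutational x) :
    J.Permutational
      (J.meet (J.comp a (J.conv a)) (J.comp (J.comp b x) (J.conv b))) := by
  refine (h.isMap_meet h.fst (h.snd.comp hx.isMap)).permutational ?_
  simpa only [J.convmeet, J.convcomp, J.convconv, J.cassoc] using
    h.isMap_meet h.fst (h.snd.comp hx.conv.isMap)

theorem permutational_swap (h : J.IsPairing a b) :
    J.Permutational (J.meet (J.comp a (J.conv b)) (J.comp b (J.conv a))) := by
  have k := h.isMap_meet h.snd h.fst
  rw [J.mcomm] at k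
  refine k.permutational ?_
  rw [J.convmeet, J.convcomp, J.convcomp, J.convconv, J.convconv, J.mcomm]
  exact k

theorem isMap_meet_left (h : J.IsPairing a b) {f g k : A} (hf : J.IsMap f) (hg : J.IsMap g)
    (hk : J.IsMap k) :
    J.IsMap (J.meet (J.meet (J.comp (J.comp f (J.conv a)) (J.conv a))
      (J.comp (J.comp g (J.conv b)) (J.conv a))) (J.comp k (J.conv b))) := by
  rw [← h.fst.1.meet_comp_conv]
  exact h.isMap_meet (h.isMap_meet hf hg) hk

theorem isMap_meet_right (h : J.IsPairing a b) {f g k : A} (hf : J.IsMap f) (hg : J.IsMap g)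
    (hk : J.IsMap k) :
    J.IsMap (J.meet (J.comp f (J.conv a)) (J.meet (J.comp (J.comp g (J.conv a)) (J.conv b))
      (J.comp (J.comp k (J.conv b)) (J.conv b)))) := by
  rw [← h.snd.1.meet_comp_conv]
  exact h.isMap_meet hf (h.isMap_meet hg hk)

theorem permutational_assoc (h : J.IsPairing a b) :
    J.Permutational (J.meet (J.meet (J.comp (J.comp a (J.conv a)) (J.conv a))
      (J.comp (J.comp (J.comp b a) (J.conv b)) (J.conv a)))
      (J.comp (J.comp b b) (J.conv b))) := by
  refine (h.isMap_meet_left h.fst (h.snd.comp h.fst) (h.snd.comp h.snd)).permutational ?_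
  simpa only [J.convmeet, J.convcomp, J.convconv, J.cassoc, J.massoc] using
    h.isMap_meet_right (h.fst.comp h.fst) (h.fst.comp h.snd) h.snd

theorem permutational_rotate (h : J.IsPairing a b) :
    J.Permutational (J.meet (J.meet (J.comp (J.comp a (J.conv b)) (J.conv b))
      (J.comp (J.comp b a) (J.conv a)))
      (J.comp (J.comp (J.comp b b) (J.conv a)) (J.conv b))) := by
  have k := h.isMap_meet_right (h.snd.comp h.fst) (h.snd.comp h.snd) h.fst
  have l := h.isMap_meet_right (h.snd.comp h.snd) h.fst (h.snd.comp h.fst)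
  rw [J.mcomm (J.comp (J.comp (J.comp b b) _) _), J.massoc,
    J.mcomm (J.comp (J.comp b a) _)] at k
  rw [J.mcomm, ← J.massoc, J.mcomm (J.comp _ (J.conv b)) (J.comp _ (J.conv a)), J.massoc,
    J.mcomm (J.comp _ (J.conv b))] at l
  refine k.permutational ?_
  simpa only [J.convmeet, J.convcomp, J.convconv, J.cassoc] using l

theorem permutational_left_comm (h : J.IsPairing a b) :
    J.Permutational (J.meet (J.meet (J.comp (J.comp a (J.conv a)) (J.conv b))
      (J.comp (J.comp b a) (J.conv a)))
      (J.comp (J.comp (J.comp b b) (J.conv b)) (J.conv b))) := by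
  have k := h.isMap_meet_right (h.snd.comp h.fst) h.fst (h.snd.comp h.snd)
  rw [J.massoc, J.mcomm (J.comp (J.comp b a) _)] at k
  refine k.permutational ?_
  rw [J.mcomm (J.comp (J.comp a _) _)] at k
  simpa only [J.convmeet, J.convcomp, J.convconv, J.cassoc] using k

end IsPairing

end JAlgebra

/-- Under (Q), (D), (U): K, L, U, U˘ are functional and
P, P₀, R, R₀, B, C, π₀ are permutational. -/
theorem generators_functional_permutational {A : Type*} (J : JAlgebra A) (a b : A)
    (ha : J.le (J.comp (J.conv a) a) J.ident)
    (hb : J.le (J.comp (J.conv b) b) J.ident)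
    (hQ : J.one = J.comp (J.conv a) b)
    (hDa : J.one = J.comp a J.one)
    (hDb : J.one = J.comp b J.one)
    (hU : J.le (J.meet (J.comp a (J.conv a)) (J.comp b (J.conv b))) J.ident)
    (K L U P P₀ R R₀ B C π₀ : A)
    (hK : K = a)
    (hL : L = b)
    (hU' : U = J.meet (J.conv a) (J.conv b))
    (hP : P = J.meet (J.comp a (J.conv b)) (J.comp b (J.conv a)))
    (hP₀ : P₀ = J.meet (J.comp (J.comp a P) (J.conv a)) (J.comp b (J.conv b)))
    (hR : R = J.meet (J.meet (J.comp (J.comp a (J.conv a)) (J.conv a))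
                (J.comp (J.comp (J.comp b a) (J.conv b)) (J.conv a)))
              (J.comp (J.comp b b) (J.conv b)))
    (hR₀ : R₀ = J.meet (J.comp (J.comp a R) (J.conv a)) (J.comp b (J.conv b)))
    (hB : B = J.meet (J.comp a (J.conv a)) (J.comp (J.comp b R) (J.conv b)))
    (hC : C = J.meet (J.meet (J.comp (J.comp a (J.conv b)) (J.conv b))
                (J.comp (J.comp b a) (J.conv a)))
              (J.comp (J.comp (J.comp b b) (J.conv a)) (J.conv b)))
    (hπ₀ : π₀ = J.meet (J.meet (J.comp (J.comp a (J.conv a)) (J.conv b))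
                (J.comp (J.comp b a) (J.conv a)))
              (J.comp (J.comp (J.comp b b) (J.conv b)) (J.conv b))) :
    J.Functional K ∧ J.Functional L ∧ J.Functional U ∧ J.Functional (J.conv U) ∧
    J.Permutational P ∧ J.Permutational P₀ ∧ J.Permutational R ∧ J.Permutational R₀ ∧
    J.Permutational B ∧ J.Permutational C ∧ J.Permutational π₀ := by
  have h : J.IsPairing a b := ⟨.of_comp_one ha hDa, .of_comp_one hb hDb, hQ.symm, hU⟩
  subst hK hL hU' hP hP₀ hR hR₀ hB hC hπ₀
  refine ⟨ha, hb, ?_, ?_, h.permutational_swap, h.permutational_map_fst h.permutational_swap,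
    h.permutational_assoc, h.permutational_map_fst h.permutational_assoc,
    h.permutational_map_snd h.permutational_assoc, h.permutational_rotate,
    h.permutational_left_comm⟩
  · refine J.le_trans ?_ hU
    rw [J.convmeet, J.convconv, J.convconv]
    exact J.le_meet (J.comp_mono (J.meet_le_left _ _) (J.meet_le_left _ _))
      (J.comp_mono (J.meet_le_right _ _) (J.meet_le_right _ _))
  · refine J.le_trans ?_ ha
    rw [J.convconv, J.convmeet, J.convconv, J.convconv]
    exact J.comp_mono (J.meet_le_left _ _) (J.meet_le_left _ _)
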